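/- Let B ⊆ A be an extension of k-algebras where A has left global dimension at most a, A/B has projective dimension at most r as a B-bimodule (i.e. as a left module over B ⊗ B^op), and A/B is projective as a right B-module. Then B has left global dimension at most r + a + 1. -/

import Mathlib

/- STATEMENT 2: If `B ⊆ A` is an extension of `k`-algebras, `A` has left global dimension
at most `a`, `A/B` has projective dimension at most `r` as a `B`-bimodule (i.e. as a
`B ⊗[k] Bᵐᵒᵖ`-module) and `A/B` is projective as a right `B`-module, then `B` has left
global dimension at most `r + a + 1`. -/

universe u v

open TensorProduct

def ProjDimLE (R : Type u) [Ring R] : ∀ (_n : ℕ) (M : Type v) [AddCommGroup M] [Module R M], Prop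
  | 0, M, _, _ => Module.Projective R M
  | n+1, M, _, _ => ∃ (P : Type v) (_ : AddCommGroup P) (_ : Module R P) (p : P →ₗ[R] M),
      Module.Projective R P ∧ Function.Surjective p ∧ ProjDimLE R n (LinearMap.ker p)

/-- `GlobalDimLE R n` : every left `R`-module has projective dimension at most `n`. -/
def GlobalDimLE (R : Type u) [Ring R] (n : ℕ) : Prop :=
  ∀ (M : Type v) [AddCommGroup M] [Module R M], ProjDimLE R n M



namespace GD

open TensorProduct

section tens
variable {A B : Type v} [Ring A] [Ring B] (f : B →+* A)
  (T : Type v) [AddCommGroup T] [Module B T]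

/-- relations defining `A ⊗_B T`. -/
def rel : Submodule A (A ⊗[ℤ] T) :=
  Submodule.span A {x | ∃ (a : A) (b : B) (t : T), x = (a * f b) ⊗ₜ t - a ⊗ₜ (b • t)}

/-- the tensor product `A ⊗_B T` over a noncommutative ring. -/
def Tens : Type v := (A ⊗[ℤ] T) ⧸ rel f T

instance : AddCommGroup (Tens f T) := inferInstanceAs (AddCommGroup ((A ⊗[ℤ] T) ⧸ rel f T))
instance instA : Module A (Tens f T) := inferInstanceAs (Module A ((A ⊗[ℤ] T) ⧸ rel f T))
instance instB : Module B (Tens f T) := Module.compHom _ f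

variable {T}

lemma smulB (b : B) (x : Tens f T) : b • x = f b • x := rfl

def tm (a : A) (t : T) : Tens f T := Submodule.Quotient.mk (a ⊗ₜ t)

lemma tm_add (a : A) (t t' : T) : tm f a (t + t') = tm f a t + tm f a t' := by
  simp only [tm, TensorProduct.tmul_add]; rfl
lemma add_tm (a a' : A) (t : T) : tm f (a + a') t = tm f a t + tm f a' t := by
  simp only [tm, TensorProduct.add_tmul]; rfl
lemma smul_tm (a a' : A) (t : T) : a • tm f a' t = tm f (a * a') t := by
  rfl
lemma ι_aux (a : A) : tm f a (0 : T) = 0 := by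
  simp only [tm, TensorProduct.tmul_zero]; rfl
lemma tm_bal (a : A) (b : B) (t : T) : tm f (a * f b) t = tm f a (b • t) := by
  refine (Submodule.Quotient.eq _).2 ?_
  exact Submodule.subset_span ⟨a, b, t, rfl⟩

lemma tm_ind {p : Tens f T → Prop} (h0 : p 0) (ht : ∀ a t, p (tm f a t))
    (ha : ∀ x y, p x → p y → p (x + y)) (x : Tens f T) : p x := by
  obtain ⟨y, rfl⟩ := Submodule.Quotient.mk_surjective _ x
  induction y using TensorProduct.induction_on with
  | zero => exact h0
  | tmul a t => exact ht a t
  | add x y hx hy => exact ha _ _ hx hy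

lemma exists_lift {G : Type*} [AddCommGroup G] (φ : A →+ T →+ G)
    (h : ∀ a b t, φ (a * f b) t = φ a (b • t)) :
    ∃ ψ : Tens f T →+ G, ∀ a t, ψ (tm f a t) = φ a t := by
  let φ' : A ⊗[ℤ] T →+ G := TensorProduct.liftAddHom φ (by
    intro r m n; rw [map_zsmul, map_zsmul]; rfl)
  have key : ∀ x ∈ rel f T, ∀ a : A, φ' (a • x) = 0 := by
    intro x hx
    refine Submodule.span_induction ?_ ?_ ?_ ?_ hx
    · rintro _ ⟨a, b, t, rfl⟩ a'
      rw [smul_sub, map_sub, sub_eq_zero, TensorProduct.smul_tmul', TensorProduct.smul_tmul']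
      change φ (a' * (a * f b)) t = φ (a' * a) (b • t)
      rw [← mul_assoc, h]
    · intro a; simp
    · intro x y _ _ hx hy a; simp [smul_add, hx, hy]
    · intro c x _ hx a; rw [smul_smul]; exact hx _
  let ψ : (A ⊗[ℤ] T) ⧸ (rel f T) →+ G := QuotientAddGroup.lift (rel f T).toAddSubgroup φ' (by
    intro x hx
    have := key x hx 1
    simpa using this)
  exact ⟨ψ, fun a t => rfl⟩

variable {T' : Type v} [AddCommGroup T'] [Module B T']

/-- extension of a `B`-linear map to an `A`-module -/
lemma exists_ext {C : Type v} [AddCommGroup C] [Module A C] (g : T →+ C)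
    (hg : ∀ b t, g (b • t) = f b • g t) :
    ∃ ψ : Tens f T →ₗ[A] C, ∀ a t, ψ (tm f a t) = a • g t := by
  obtain ⟨ψ, hψ⟩ := exists_lift f (G := C) (T := T)
    (AddMonoidHom.mk' (fun a => AddMonoidHom.mk' (fun t => a • g t) (by intros; simp))
      (by intros; ext; simp [add_smul])) (by intro a b t; simp [hg, mul_smul])
  refine ⟨{ ψ with map_smul' := ?_ }, hψ⟩
  intro a x
  change ψ (a • x) = a • ψ x
  induction x using tm_ind with
  | h0 => simp
  | ht a' t => rw [smul_tm, hψ, hψ]; simp [mul_smul]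
  | ha x y hx hy => simp [hx, hy]

lemma exists_map (g : T →ₗ[B] T') :
    ∃ ψ : Tens f T →ₗ[A] Tens f T', ∀ a t, ψ (tm f a t) = tm f a (g t) := by
  obtain ⟨ψ, hψ⟩ := exists_ext f (T := T) (C := Tens f T')
    (AddMonoidHom.mk' (fun t => tm f 1 (g t)) (by intros; simp [tm_add]))
    (by intro b t; simp [← tm_bal, smul_tm])
  exact ⟨ψ, fun a t => by rw [hψ]; simp [smul_tm]⟩

noncomputable def tmap (g : T →ₗ[B] T') : Tens f T →ₗ[A] Tens f T' := (exists_map f g).choose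
lemma tmap_tm (g : T →ₗ[B] T') (a : A) (t : T) : tmap f g (tm f a t) = tm f a (g t) :=
  (exists_map f g).choose_spec a t

variable (T) in
/-- the unit `T → A ⊗_B T` -/
def ι : T →ₗ[B] Tens f T where
  toFun t := tm f 1 t
  map_add' := tm_add f 1
  map_smul' b t := by simp [smulB, smul_tm, ← tm_bal]

variable (T) in
/-- `(A ⊗_B T)/T`, i.e. `(A/B) ⊗_B T` -/
abbrev Nt : Type v := Tens f T ⧸ LinearMap.range (ι f T)

end tens

/-- finite dual bases for right modules -/
structure RC (B : Type v) [Ring B] (L : Type v) [AddCommGroup L] (ract : L → B → L) where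
  J : Type v
  c : J → L →+ B
  p : J → L
  hc : ∀ j l b, c j (ract l b) = c j l * b
  hp : ∀ l, ∃ s : Finset J, ∀ s', s ⊆ s' → ∑ j ∈ s', ract (p j) (c j l) = l

section exact
variable {A B : Type v} [Ring A] [Ring B] (f : B →+* A) (R : RC B A (fun a b => a * f b))
variable {T : Type v} [AddCommGroup T] [Module B T]
variable {T' : Type v} [AddCommGroup T'] [Module B T']
variable {T'' : Type v} [AddCommGroup T''] [Module B T'']

lemma exists_coord (j : R.J) : ∃ ψ : Tens f T →+ T, ∀ a t, ψ (tm f a t) = R.c j a • t :=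
  exists_lift f (G := T) (T := T)
    (AddMonoidHom.mk' (fun a => AddMonoidHom.mk' (fun t => R.c j a • t) (by intros; simp))
      (by intros; ext; simp [add_smul])) (by intro a b t; simp [R.hc, mul_smul])

noncomputable def coord (T : Type v) [AddCommGroup T] [Module B T] (j : R.J) : Tens f T →+ T :=
  (exists_coord f R j).choose

lemma coord_tm (j : R.J) (a : A) (t : T) : coord f R T j (tm f a t) = R.c j a • t :=
  (exists_coord f R j).choose_spec a t

lemma coord_sum (x : Tens f T) : ∃ s : Finset R.J, ∀ s', s ⊆ s' →
    ∑ j ∈ s', tm f (R.p j) (coord f R T j x) = x := by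
  classical
  induction x using tm_ind with
  | h0 => exact ⟨∅, fun s' _ => Finset.sum_eq_zero (fun j _ => by
      rw [map_zero]; exact (ι_aux f _))⟩
  | ht a t =>
    obtain ⟨s, hs⟩ := R.hp a
    refine ⟨s, fun s' h => ?_⟩
    conv_rhs => rw [← hs s' h]
    simp only [coord_tm, ← tm_bal]
    exact (map_sum (AddMonoidHom.mk' (fun a => tm f a t) (fun a a' => add_tm f a a' t)) _ _).symm
  | ha x y hx hy =>
    obtain ⟨s, hs⟩ := hx
    obtain ⟨s2, hs2⟩ := hy
    refine ⟨s ∪ s2, fun s' h => ?_⟩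
    simp only [map_add, tm_add, Finset.sum_add_distrib]
    rw [hs s' (Finset.union_subset_left h), hs2 s' (Finset.union_subset_right h)]

lemma coord_nat (g : T →ₗ[B] T') (j : R.J) (x : Tens f T) :
    coord f R T' j (tmap f g x) = g (coord f R T j x) := by
  induction x using tm_ind with
  | h0 => simp
  | ht a t => simp [tmap_tm, coord_tm]
  | ha x y hx hy => simp [hx, hy]

lemma tmap_inj (R : RC B A (fun a b => a * f b)) (g : T →ₗ[B] T') (hg : Function.Injective g) : Function.Injective (tmap f g) := by
  rw [injective_iff_map_eq_zero]
  intro x hx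
  obtain ⟨s, hs⟩ := coord_sum f R x
  rw [← hs s le_rfl]
  refine Finset.sum_eq_zero fun j _ => ?_
  have : g (coord f R T j x) = 0 := by rw [← coord_nat, hx, map_zero]
  rw [(map_eq_zero_iff g hg).1 this]; exact ι_aux f _

lemma tmap_exact (R : RC B A (fun a b => a * f b)) (g : T →ₗ[B] T') (h : T' →ₗ[B] T'') (e : Function.Exact g h) :
    Function.Exact (tmap f g) (tmap f h) := by
  intro x
  constructor
  · intro hx
    obtain ⟨s, hs⟩ := coord_sum f R x
    rw [← hs s le_rfl]
    refine (LinearMap.range (tmap f g)).sum_mem fun j _ => ?_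
    have : h (coord f R T' j x) = 0 := by rw [← coord_nat, hx, map_zero]
    obtain ⟨y, hy⟩ := (e _).1 this
    exact ⟨tm f (R.p j) y, by rw [tmap_tm, hy]⟩
  · rintro ⟨y, rfl⟩
    induction y using tm_ind with
    | h0 => simp
    | ht a t => rw [tmap_tm, tmap_tm, e.apply_apply_eq_zero]; exact ι_aux f _
    | ha x y hx hy => simp [hx, hy]

end exact
lemma tmap_surj {A B : Type v} [Ring A] [Ring B] (f : B →+* A)
    {T : Type v} [AddCommGroup T] [Module B T]
    {T' : Type v} [AddCommGroup T'] [Module B T'] (h : T →ₗ[B] T')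
    (hs : Function.Surjective h) : Function.Surjective (tmap f h) := by
  intro x
  induction x using tm_ind with
  | h0 => exact ⟨0, map_zero _⟩
  | ht a t => obtain ⟨y, rfl⟩ := hs t; exact ⟨_, tmap_tm f h a y⟩
  | ha x y hx hy =>
    obtain ⟨x, rfl⟩ := hx
    obtain ⟨y, rfl⟩ := hy
    exact ⟨x + y, map_add _ _ _⟩


end GD


namespace GD

set_option linter.unusedSectionVars false

/-- enveloping algebra -/
abbrev En (k : Type u) [CommRing k] (B : Type v) [Ring B] [Algebra k B] : Type v := B ⊗[k] Bᵐᵒᵖ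

section bal
variable (k : Type u) [CommRing k] {B : Type v} [Ring B] [Algebra k B]

/-- right action of `B` on a module over the enveloping algebra -/
def ra {L : Type v} [AddCommGroup L] [Module (En k B) L] (l : L) (b : B) : L :=
  ((1 : B) ⊗ₜ[k] (MulOpposite.op b) : En k B) • l

variable {L : Type v} [AddCommGroup L] [Module (En k B) L] [Module B L] [IsScalarTower B (En k B) L]
variable {T U C : Type v} [AddCommGroup T] [Module B T] [AddCommGroup U] [Module B U]
  [AddCommGroup C] [Module B C]

lemma act_eq (b b' : B) (l : L) :
    ((b ⊗ₜ[k] (MulOpposite.op b') : En k B)) • l = b • ra k l b' := by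
  rw [ra, ← smul_assoc, TensorProduct.smul_tmul', smul_eq_mul, mul_one]

lemma ra_smul (b b' : B) (l : L) : ra k (b • l) b' = b • ra k l b' := by
  rw [← act_eq, ra]
  have : b • l = ((b ⊗ₜ[k] (MulOpposite.op 1) : En k B)) • l := by
    rw [act_eq, ra]
    exact congrArg (b • ·) (one_smul (En k B) l).symm
  rw [this, ← mul_smul, Algebra.TensorProduct.tmul_mul_tmul]
  simp

lemma ra_add (b : B) (l l' : L) : ra k (l + l') b = ra k l b + ra k l' b := smul_add _ _ _
lemma ra_zero (b : B) : ra k (0 : L) b = 0 := smul_zero _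
lemma ra_add' (b b' : B) (l : L) : ra k l (b + b') = ra k l b + ra k l b' := by
  simp only [ra, MulOpposite.op_add, TensorProduct.tmul_add, add_smul]
lemma ra_zero' (l : L) : ra k l (0 : B) = 0 := by
  have h : ((1 : B) ⊗ₜ[k] (MulOpposite.op (0 : B)) : En k B) = 0 := TensorProduct.tmul_zero _ _
  rw [ra, h]; exact zero_smul (En k B) l
lemma ra_mul (b b' : B) (l : L) : ra k l (b * b') = ra k (ra k l b) b' := by
  simp only [ra, ← mul_smul, Algebra.TensorProduct.tmul_mul_tmul]
  simp
lemma ra_one (l : L) : ra k l (1 : B) = l := one_smul (En k B) l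

lemma ra_alg (c : k) (l : L) : ra k l (algebraMap k B c) = algebraMap k B c • l := by
  have : algebraMap k B c • l = ((algebraMap k B c ⊗ₜ[k] (MulOpposite.op 1) : En k B)) • l := by
    rw [act_eq, ra_one]
  rw [this, ra, Algebra.algebraMap_eq_smul_one, TensorProduct.smul_tmul]
  rfl

/-- balanced biadditive maps -/
structure Bal (B : Type v) [Ring B] [Algebra k B] {L : Type v} [AddCommGroup L]
    [Module (En k B) L] [Module B L] {T U : Type v} [AddCommGroup T] [Module B T]
    [AddCommGroup U] [Module B U] (θ : L →+ T →+ U) : Prop where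
  l : ∀ (b : B) (l : L) (t : T), θ (b • l) t = b • θ l t
  r : ∀ (b : B) (l : L) (t : T), θ (ra k l b) t = θ l (b • t)

variable {k}

lemma bal_lift [Module.Projective (En k B) L] {θ : L →+ T →+ U} (hθ : Bal k B θ) (π : C →ₗ[B] U)
    (σ : U →+ C) (hσ : ∀ u, π (σ u) = u)
    (hk : ∀ (c : k) u, σ (algebraMap k B c • u) = algebraMap k B c • σ u) :
    ∃ θ' : L →+ T →+ C, Bal k B θ' ∧ ∀ l t, π (θ' l t) = θ l t := by
  classical
  have hbi : ∀ p : L, ∃ Ψ : En k B →+ T →+ C, ∀ b b' t,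
      Ψ (b ⊗ₜ[k] MulOpposite.op b') t = b • σ (θ p (b' • t)) := by
    intro p
    refine ⟨TensorProduct.liftAddHom (AddMonoidHom.mk' (fun b => AddMonoidHom.mk' (fun b' =>
      AddMonoidHom.mk' (fun t => b • σ (θ p (b'.unop • t))) (by intros; simp))
      (by intros; ext; simp [add_smul])) (by intros; ext; simp [add_smul])) ?_, ?_⟩
    · intro c b b'
      ext t
      change (c • b) • σ (θ p (b'.unop • t)) = b • σ (θ p ((c • b').unop • t))
      rw [MulOpposite.unop_smul, Algebra.smul_def, Algebra.smul_def, Algebra.commutes, mul_smul,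
        ← hk, mul_smul, ← hθ.r (algebraMap k B c), ra_alg, hθ.l]
    · intro b b' t
      rfl
  choose Ψ hΨ using hbi
  have h1 : ∀ p (b : B) e t, Ψ p (b • e) t = b • Ψ p e t := by
    intro p b e t
    induction e using TensorProduct.induction_on with
    | zero => simp
    | tmul x y =>
      obtain ⟨y, rfl⟩ := MulOpposite.op_surjective y
      rw [TensorProduct.smul_tmul', hΨ, hΨ, smul_smul, smul_eq_mul]
    | add x y hx hy => simp [hx, hy]
  have h2 : ∀ p (b : B) e t, Ψ p (((1 : B) ⊗ₜ[k] (MulOpposite.op b) : En k B) * e) t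
      = Ψ p e (b • t) := by
    intro p b e t
    induction e using TensorProduct.induction_on with
    | zero => simp
    | tmul x y =>
      obtain ⟨y, rfl⟩ := MulOpposite.op_surjective y
      rw [Algebra.TensorProduct.tmul_mul_tmul, ← MulOpposite.op_mul, hΨ, hΨ, one_mul, mul_smul]
    | add x y hx hy => simp [hx, hy, mul_add]
  have h3 : ∀ p e t, π (Ψ p e t) = θ (e • p) t := by
    intro p e t
    induction e using TensorProduct.induction_on with
    | zero =>
      have h : (0 : En k B) • p = 0 := zero_smul (En k B) p
      erw [h]; simp
    | tmul x y =>
      obtain ⟨y, rfl⟩ := MulOpposite.op_surjective y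
      rw [hΨ, act_eq, hθ.l, hθ.r, map_smul, hσ]
    | add x y hx hy => simp [hx, hy, add_smul]
  obtain ⟨s, hs⟩ := (Module.projective_def'.1 ‹Module.Projective (En k B) L›)
  let Φ : (L →₀ En k B) →+ T →+ C := Finsupp.liftAddHom (fun p => Ψ p)
  have hΦ : ∀ p e, Φ (Finsupp.single p e) = Ψ p e := by intro p e; simp [Φ]
  refine ⟨Φ.comp s.toAddMonoidHom, ⟨?_, ?_⟩, ?_⟩
  · intro b l t
    change Φ (s (b • l)) t = b • Φ (s l) t
    have : s (b • l) = b • s l := (s.restrictScalars B).map_smul b l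
    rw [this]
    generalize s l = x
    induction x using Finsupp.induction_linear with
    | zero => simp
    | add x y hx hy => simp [hx, hy]
    | single p e => rw [Finsupp.smul_single, hΦ, hΦ, h1]
  · intro b l t
    change Φ (s (ra k l b)) t = Φ (s l) (b • t)
    rw [ra, s.map_smul]
    generalize s l = x
    induction x using Finsupp.induction_linear with
    | zero => simp
    | add x y hx hy => simp [hx, hy]
    | single p e => rw [Finsupp.smul_single, hΦ, hΦ, smul_eq_mul, h2]
  · intro l t
    change π (Φ (s l) t) = θ l t
    have : Finsupp.linearCombination (En k B) (id : L → L) (s l) = l := LinearMap.congr_fun hs l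
    conv_rhs => rw [← this]
    generalize s l = x
    induction x using Finsupp.induction_linear with
    | zero => simp
    | add x y hx hy => simp [hx, hy]
    | single p e => rw [hΦ, h3]; simp

end bal
end GD


namespace GD

set_option linter.unusedSectionVars false

section fin
variable (k : Type u) [CommRing k] {B : Type v} [Ring B] [Algebra k B]
variable {L : Type v} [AddCommGroup L] [Module (En k B) L] [Module B L] [IsScalarTower B (En k B) L]
variable {P : Type v} [AddCommGroup P] [Module (En k B) P] [Module B P] [IsScalarTower B (En k B) P]
variable {T U C : Type v} [AddCommGroup T] [Module B T] [AddCommGroup U] [Module B U]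
  [AddCommGroup C] [Module B C]
variable {I I0 I1 I2 : Type v}

noncomputable def lam (l : L) : (I →₀ B) →+ (I →₀ L) :=
  Finsupp.mapRange.addMonoidHom (AddMonoidHom.mk' (fun b => ra k l b) (fun b b' => ra_add' k b b' l))

lemma lam_apply (l : L) (x : I →₀ B) (i : I) : lam k l x i = ra k l (x i) := rfl

noncomputable def dL (D : I1 → (I0 →₀ B)) : (I1 →₀ L) →ₗ[B] (I0 →₀ L) :=
  Finsupp.lsum ℕ (fun i =>
    { toFun := fun l => lam k l (D i)
      map_add' := fun l l' => by ext j; simp [lam_apply, ra_add]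
      map_smul' := fun b l => by ext j; simp [lam_apply, ra_smul] })

lemma dL_single (D : I1 → (I0 →₀ B)) (i : I1) (l : L) :
    dL k D (Finsupp.single i l) = lam k l (D i) := by
  rw [dL, Finsupp.lsum_single]; rfl

lemma dL_lam (D : I1 → (I0 →₀ B)) (l : L) (x : I1 →₀ B) :
    dL k D (lam k l x) = lam k l (Finsupp.linearCombination B D x) := by
  induction x using Finsupp.induction_linear with
  | zero => simp
  | add x y hx hy => simp [hx, hy]
  | single i b =>
    have : lam k l (Finsupp.single i b) = Finsupp.single i (ra k l b) := by
      simp [lam]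
    rw [this, dL_single]
    ext j
    simp [lam_apply, ra_mul]

lemma dL_dL (D : I1 → (I0 →₀ B)) (D2 : I2 → (I1 →₀ B))
    (h : ∀ i, Finsupp.linearCombination B D (D2 i) = 0) (x : I2 →₀ L) :
    dL k D (dL k D2 x) = 0 := by
  induction x using Finsupp.induction_linear with
  | zero => simp
  | add x y hx hy => simp [hx, hy]
  | single i l => rw [dL_single, dL_lam, h, map_zero]

variable {k} in
noncomputable def ev {θ : L →+ T →+ U} (hθ : Bal k B θ) (t : I → T) : (I →₀ L) →ₗ[B] U :=
  Finsupp.lsum ℕ (fun i =>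
    { toFun := fun l => θ l (t i)
      map_add' := fun l l' => by simp
      map_smul' := fun b l => by simp [hθ.l] })

lemma ev_single {θ : L →+ T →+ U} (hθ : Bal k B θ) (t : I → T) (i : I) (l : L) :
    ev hθ t (Finsupp.single i l) = θ l (t i) := by
  simp [ev]

lemma ev_lam {θ : L →+ T →+ U} (hθ : Bal k B θ) (t : I → T) (l : L) (x : I →₀ B) :
    ev hθ t (lam k l x) = θ l (Finsupp.linearCombination B t x) := by
  induction x using Finsupp.induction_linear with
  | zero => simp
  | add x y hx hy => simp [hx, hy]
  | single i b =>
    have : lam k l (Finsupp.single i b) = Finsupp.single i (ra k l b) := by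
      simp [lam]
    rw [this, ev_single, hθ.r]
    simp

lemma ev_dL {θ : L →+ T →+ U} (hθ : Bal k B θ) (t : I0 → T) (D : I1 → (I0 →₀ B))
    (h : ∀ i, Finsupp.linearCombination B t (D i) = 0) (x : I1 →₀ L) :
    ev hθ t (dL k D x) = 0 := by
  induction x using Finsupp.induction_linear with
  | zero => simp
  | add x y hx hy => simp [hx, hy]
  | single i l => rw [dL_single, ev_lam, h, map_zero]

/-- functoriality of `I →₀ -` for bimodule maps -/
noncomputable def fm (I : Type v) (p : P →ₗ[En k B] L) : (I →₀ P) →ₗ[B] (I →₀ L) :=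
  Finsupp.mapRange.linearMap (p.restrictScalars B)

lemma fm_single (p : P →ₗ[En k B] L) (i : I) (l : P) :
    fm k I p (Finsupp.single i l) = Finsupp.single i (p l) := by
  simp [fm]

lemma fm_apply (p : P →ₗ[En k B] L) (i : I) (x : I →₀ P) :
    fm k I p x i = p (x i) := rfl

lemma dL_fm (p : P →ₗ[En k B] L) (D : I1 → (I0 →₀ B)) (x : I1 →₀ P) :
    dL k D (fm k I1 p x) = fm k I0 p (dL k D x) := by
  induction x using Finsupp.induction_linear with
  | zero => simp
  | add x y hx hy => simp [hx, hy]
  | single i l =>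
    rw [fm_single, dL_single, dL_single]
    ext j
    simp [fm_apply, lam_apply, ra]

lemma ev_fm (p : P →ₗ[En k B] L) {θ : L →+ T →+ U} (hθ : Bal k B θ) {θ' : P →+ T →+ U}
    (hθ' : Bal k B θ') (h : ∀ l t, θ (p l) t = θ' l t) (t : I → T) (x : I →₀ P) :
    ev hθ t (fm k I p x) = ev hθ' t x := by
  induction x using Finsupp.induction_linear with
  | zero => simp
  | add x y hx hy => simp [hx, hy]
  | single i l => rw [fm_single, ev_single, ev_single, h]

lemma ev_post (π : C →ₗ[B] U) {θ : L →+ T →+ C} (hθ : Bal k B θ) {θ' : L →+ T →+ U}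
    (hθ' : Bal k B θ') (h : ∀ l t, π (θ l t) = θ' l t) (t : I → T) (x : I →₀ L) :
    π (ev hθ t x) = ev hθ' t x := by
  induction x using Finsupp.induction_linear with
  | zero => simp
  | add x y hx hy => simp [hx, hy]
  | single i l => rw [ev_single, ev_single, h]

variable (R : RC B L (ra k))

noncomputable def cf (I : Type v) (j : R.J) : (I →₀ L) →+ (I →₀ B) :=
  Finsupp.mapRange.addMonoidHom (R.c j)

lemma cf_single (j : R.J) (i : I) (l : L) :
    cf k R I j (Finsupp.single i l) = Finsupp.single i (R.c j l) := by
  simp [cf]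

lemma cf_dL (j : R.J) (D : I1 → (I0 →₀ B)) (x : I1 →₀ L) :
    cf k R I0 j (dL k D x) = Finsupp.linearCombination B D (cf k R I1 j x) := by
  induction x using Finsupp.induction_linear with
  | zero => simp
  | add x y hx hy => simp [hx, hy]
  | single i l =>
    rw [dL_single, cf_single]
    ext a
    simp only [Finsupp.linearCombination_single, Finsupp.smul_apply, smul_eq_mul, ← R.hc]
    rfl

lemma cf_sum (x : I →₀ L) : ∃ s : Finset R.J, ∀ s', s ⊆ s' →
    ∑ j ∈ s', lam k (R.p j) (cf k R I j x) = x := by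
  classical
  induction x using Finsupp.induction_linear with
  | zero => exact ⟨∅, fun s' _ => Finset.sum_eq_zero (fun j _ => by simp)⟩
  | single i l =>
    obtain ⟨s, hs⟩ := R.hp l
    refine ⟨s, fun s' h => ?_⟩
    conv_rhs => rw [← hs s' h]
    rw [Finsupp.single_finsetSum]
    refine Finset.sum_congr rfl fun j _ => ?_
    rw [cf_single]
    simp [lam]
  | add x y hx hy =>
    obtain ⟨s, hs⟩ := hx
    obtain ⟨s2, hs2⟩ := hy
    refine ⟨s ∪ s2, fun s' h => ?_⟩
    simp only [map_add, Finset.sum_add_distrib]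
    rw [hs s' (Finset.union_subset_left h), hs2 s' (Finset.union_subset_right h)]

lemma mem_of_cf (D : I1 → (I0 →₀ B)) (x : I0 →₀ L) (h : ∀ j, ∃ i, D i = cf k R I0 j x) :
    ∃ y, dL k D y = x := by
  obtain ⟨s, hs⟩ := cf_sum k R x
  rw [← hs s le_rfl]
  refine (LinearMap.range (dL k D)).sum_mem fun j _ => ?_
  obtain ⟨i, hi⟩ := h j
  exact ⟨Finsupp.single i (R.p j), by rw [dL_single, hi]⟩

lemma dL_ex (R : RC B L (ra k)) (D : I1 → (I0 →₀ B)) (D2 : I2 → (I1 →₀ B))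
    (h : ∀ x, Finsupp.linearCombination B D x = 0 → ∃ i, D2 i = x) (x : I1 →₀ L)
    (hx : dL k D x = 0) : ∃ y, dL k D2 y = x := by
  refine mem_of_cf k R D2 x fun j => h _ ?_
  rw [← cf_dL, hx, map_zero]

lemma ev_ex {θ : L →+ T →+ U} (hθ : Bal k B θ) (κ : R.J → U →+ T)
    (hκ : ∀ j l t, κ j (θ l t) = R.c j l • t) (t : I0 → T) (D : I1 → (I0 →₀ B))
    (h : ∀ x, Finsupp.linearCombination B t x = 0 → ∃ i, D i = x) (x : I0 →₀ L)
    (hx : ev hθ t x = 0) : ∃ y, dL k D y = x := by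
  refine mem_of_cf k R D x fun j => h _ ?_
  have : ∀ x, κ j (ev hθ t x) = Finsupp.linearCombination B t (cf k R I0 j x) := by
    intro x
    induction x using Finsupp.induction_linear with
    | zero => simp
    | add x y hx hy => simp [hx, hy]
    | single i l => rw [cf_single, ev_single, hκ]; simp
  rw [← this, hx, map_zero]

end fin

/-- a set-level free resolution of a module -/
structure Res (B : Type v) [Ring B] (T : Type v) [AddCommGroup T] [Module B T] where
  I : ℕ → Type v
  D : ∀ q, I (q + 1) → (I q →₀ B)
  t : I 0 → T
  ht : Function.Surjective t
  h0 : ∀ i, Finsupp.linearCombination B t (D 0 i) = 0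
  h1 : ∀ q i, Finsupp.linearCombination B (D q) (D (q + 1) i) = 0
  e0 : ∀ x, Finsupp.linearCombination B t x = 0 → ∃ i, D 0 i = x
  e1 : ∀ q x, Finsupp.linearCombination B (D q) x = 0 → ∃ i, D (q + 1) i = x

noncomputable def syz (B : Type v) [Ring B] (T : ModuleCat.{v} B) : ℕ → ModuleCat.{v} B
  | 0 => T
  | n + 1 => ModuleCat.of B (LinearMap.ker (Finsupp.linearCombination B (id : syz B T n → syz B T n)))

noncomputable def res (B : Type v) [Ring B] (T : Type v) [AddCommGroup T] [Module B T] : Res B T where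
  I n := syz B (ModuleCat.of B T) n
  D q := fun i => (LinearMap.ker (Finsupp.linearCombination B
    (id : syz B (ModuleCat.of B T) q → syz B (ModuleCat.of B T) q))).subtype i
  t := fun i => i
  ht := Function.surjective_id
  h0 := fun i => i.2
  h1 := fun q i => by
    have h : ∀ x, Finsupp.linearCombination B ((LinearMap.ker (Finsupp.linearCombination B
        (id : syz B (ModuleCat.of B T) q → syz B (ModuleCat.of B T) q))).subtype) x
        = (LinearMap.ker (Finsupp.linearCombination B
        (id : syz B (ModuleCat.of B T) q → syz B (ModuleCat.of B T) q))).subtype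
          (Finsupp.linearCombination B id x) := by
      intro x
      rw [LinearMap.map_finsupp_linearCombination]
      rfl
    refine (h _).trans ?_
    have : Finsupp.linearCombination B (id : syz B (ModuleCat.of B T) (q+1) → _) i.1 = 0 := i.2
    erw [this]
    rfl
  e0 := fun x hx => ⟨⟨x, hx⟩, rfl⟩
  e1 := fun q x hx => by
    have h : ∀ x, Finsupp.linearCombination B ((LinearMap.ker (Finsupp.linearCombination B
        (id : syz B (ModuleCat.of B T) q → syz B (ModuleCat.of B T) q))).subtype) x
        = (LinearMap.ker (Finsupp.linearCombination B
        (id : syz B (ModuleCat.of B T) q → syz B (ModuleCat.of B T) q))).subtype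
          (Finsupp.linearCombination B id x) := by
      intro x
      rw [LinearMap.map_finsupp_linearCombination]
      rfl
    refine ⟨⟨x, Subtype.ext ((h x).symm.trans hx)⟩, rfl⟩

end GD


namespace GD

set_option linter.unusedSectionVars false

lemma fac_inj {B : Type v} [Ring B] {X Y Z : Type v} [AddCommGroup X] [Module B X]
    [AddCommGroup Y] [Module B Y] [AddCommGroup Z] [Module B Z] (m : X →ₗ[B] Y)
    (hm : Function.Injective m) (u : Z →ₗ[B] Y) (h : ∀ z, ∃ x, m x = u z) :
    ∃ w : Z →ₗ[B] X, ∀ z, m (w z) = u z := by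
  choose w hw using h
  exact ⟨{ toFun := w
           map_add' := fun a b => hm (by simp [hw])
           map_smul' := fun a b => hm (by simp [hw]) }, hw⟩

lemma fac_proj {B : Type v} [Ring B] {X Y Z : Type v} [AddCommGroup X] [Module B X]
    [AddCommGroup Y] [Module B Y] [AddCommGroup Z] [Module B Z] [Module.Projective B Z]
    (m : X →ₗ[B] Y) (u : Z →ₗ[B] Y) (h : ∀ z, ∃ x, m x = u z) :
    ∃ w : Z →ₗ[B] X, ∀ z, m (w z) = u z := by
  obtain ⟨w, hw⟩ := Module.projective_lifting_property m.rangeRestrict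
    (u.codRestrict (LinearMap.range m) h) (LinearMap.surjective_rangeRestrict m)
  exact ⟨w, fun z => congrArg Subtype.val (LinearMap.congr_fun hw z)⟩

lemma exists_seq {S : ℕ → Type v} (s0 : S 0) (R : ∀ q, S q → S (q + 1) → Prop)
    (h : ∀ q s, ∃ s', R q s s') : ∃ s : ∀ q, S q, s 0 = s0 ∧ ∀ q, R q (s q) (s (q + 1)) := by
  choose n hn using h
  exact ⟨fun q => Nat.rec s0 n q, rfl, fun q => hn q _⟩

section del
variable {A B : Type v} [Ring A] [Ring B] (f : B →+* A)

noncomputable def Nit (T : ModuleCat.{v} B) : ℕ → ModuleCat.{v} B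
  | 0 => T
  | i + 1 => ModuleCat.of B (Nt f (Nit T i))

/-- the quotient map `A ⊗ N^i ⊗ T → N^{i+1} ⊗ T` -/
noncomputable def mkN (T : ModuleCat.{v} B) (i : ℕ) :
    Tens f (Nit f T i) →ₗ[B] Nit f T (i + 1) :=
  (LinearMap.range (ι f (Nit f T i))).mkQ

lemma mkN_eq (T : ModuleCat.{v} B) (i : ℕ) (x) : mkN f T i x = 0 ↔ ∃ t, ι f (Nit f T i) t = x :=
  Submodule.Quotient.mk_eq_zero _

lemma mkN_surj (T : ModuleCat.{v} B) (i : ℕ) : Function.Surjective (mkN f T i) :=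
  Submodule.mkQ_surjective _

def Del (T : ModuleCat.{v} B) : ∀ (i : ℕ) (Q : ℕ → Type v) [∀ n, AddCommGroup (Q n)]
    [∀ n, Module B (Q n)] (_d : ∀ n, Q (n + 1) →ₗ[B] Q n)
    (_x : Q 0 →ₗ[B] Nit f T i) (_y : Q i →ₗ[B] T), Prop
  | 0, _, _, _, _, x, y => x = y
  | i + 1, Q, _, _, d, x, y => ∃ xh : Q 0 →ₗ[B] Tens f (Nit f T i), (∀ z, mkN f T i (xh z) = x z) ∧
      ∃ x' : Q 1 →ₗ[B] Nit f T i, (∀ z, ι f (Nit f T i) (x' z) = xh (d 0 z)) ∧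
        Del T i (fun n => Q (n + 1)) (fun n => d (n + 1)) x' y

def XQ (Q : ℕ → Type v) [∀ n, AddCommGroup (Q n)]
    [∀ n, Module B (Q n)] (d : ∀ n, Q (n + 1) →ₗ[B] Q n) : Prop :=
  ∀ (n : ℕ) (T : Type v) [AddCommGroup T] [Module B T] (c : Q (n + 1) →ₗ[B] Tens f T),
    (∀ z, c (d (n + 1) z) = 0) → ∃ b : Q n →ₗ[B] Tens f T, ∀ z, c z = b (d n z)

lemma D1 (T : ModuleCat.{v} B) : ∀ (i : ℕ) (Q : ℕ → Type v) [∀ n, AddCommGroup (Q n)]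
    [∀ n, Module B (Q n)] (d : ∀ n, Q (n + 1) →ₗ[B] Q n) (_hX : XQ f Q d)
    (y : Q (i + 1) →ₗ[B] T) (_hy : ∀ z, y (d (i + 1) z) = 0),
    ∃ x : Q 1 →ₗ[B] Nit f T i, (∀ z, x (d 1 z) = 0) ∧
      Del f T i (fun n => Q (n + 1)) (fun n => d (n + 1)) x y
  | 0, Q, _, _, d, hX, y, hy => ⟨y, hy, rfl⟩
  | i + 1, Q, _, _, d, hX, y, hy => by
    obtain ⟨x, hx, hD⟩ := D1 T i (fun n => Q (n + 1)) (fun n => d (n + 1))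
      (fun n => hX (n + 1)) y hy
    obtain ⟨b, hb⟩ := hX 1 _ ((ι f (Nit f T i)).comp x) (fun z => by
      have := hx z
      simp only [LinearMap.comp_apply]
      rw [this, map_zero])
    refine ⟨(mkN f T i).comp b, fun z => ?_, b, fun z => rfl, x, fun z => hb z, hD⟩
    exact (mkN_eq f T i _).2 ⟨x z, hb z⟩

lemma D2 (hι : ∀ (T : Type v) [AddCommGroup T] [Module B T], Function.Injective (ι f T))
    (T : ModuleCat.{v} B) : ∀ (i : ℕ) (Q : ℕ → Type v) [∀ n, AddCommGroup (Q n)]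
    [∀ n, Module B (Q n)] (d : ∀ n, Q (n + 1) →ₗ[B] Q n)
    (_hQ : ∀ n, Module.Projective B (Q n)) (_hd : ∀ n z, d n (d (n + 1) z) = 0)
    (x x' : Q 1 →ₗ[B] Nit f T i) (y y' : Q (i + 1) →ₗ[B] T)
    (_hx : Del f T i (fun n => Q (n + 1)) (fun n => d (n + 1)) x y)
    (_hx' : Del f T i (fun n => Q (n + 1)) (fun n => d (n + 1)) x' y')
    (e : Q 0 →ₗ[B] Nit f T i) (_he : ∀ z, x z - x' z = e (d 0 z)),
    ∃ e' : Q i →ₗ[B] T, ∀ z, y z - y' z = e' (d i z)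
  | 0, Q, _, _, d, hQ, hd, x, x', y, y', hx, hx', e, he => by
    change x = y at hx
    change x' = y' at hx'
    subst hx hx'
    exact ⟨e, he⟩
  | i + 1, Q, _, _, d, hQ, hd, x, x', y, y', hx, hx', e, he => by
    obtain ⟨xh, h1, w, h2, h3⟩ := hx
    obtain ⟨xh', h1', w', h2', h3'⟩ := hx'
    have := hQ 0
    obtain ⟨et, het⟩ := fac_proj (mkN f T i) e (fun z => mkN_surj f T i _)
    obtain ⟨v, hv⟩ := fac_inj (ι f (Nit f T i)) (hι _) (xh - xh' - et.comp (d 0)) (fun z => by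
      refine (mkN_eq f T i _).1 ?_
      have e1 := h1 z
      have e2 := h1' z
      have e3 := het (d 0 z)
      have e4 := he z
      simp only [LinearMap.sub_apply, LinearMap.comp_apply, map_sub]
      rw [e1, e2, e3, e4, sub_self])
    refine D2 hι T i (fun n => Q (n + 1)) (fun n => d (n + 1)) (fun n => hQ _) (fun n => hd _)
      w w' y y' h3 h3' v (fun z => hι _ ?_)
    have e1 := h2 z
    have e2 := h2' z
    rw [map_sub, e1, e2]
    change _ = ι f (Nit f T i) (v (d 1 z))
    rw [hv]
    simp [hd]

end del

section C
variable {k : Type u} [CommRing k] {A B : Type v} [Ring A] [Ring B] [Algebra k B] (f : B →+* A)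

lemma lemC (hι : ∀ (T : Type v) [AddCommGroup T] [Module B T], Function.Injective (ι f T))
    (hσ : ∀ (T : Type v) [AddCommGroup T] [Module B T], ∃ σ : Nt f T →+ Tens f T,
      (∀ u, (LinearMap.range (ι f T)).mkQ (σ u) = u) ∧
      ∀ (c : k) u, σ (algebraMap k B c • u) = algebraMap k B c • σ u)
    (T : ModuleCat.{v} B) {T' : Type v} [AddCommGroup T'] [Module B T'] (X : Res B T') :
    ∀ (j : ℕ) (L : Type v) [AddCommGroup L] [Module (En k B) L] [Module B L]
    [IsScalarTower B (En k B) L] (_hL : ProjDimLE (En k B) j L)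
    (Q : ℕ → Type v) [∀ n, AddCommGroup (Q n)]
    [∀ n, Module B (Q n)] (d : ∀ n, Q (n + 1) →ₗ[B] Q n)
    (_hQ : ∀ n, Module.Projective B (Q n)) (_hd : ∀ n z, d n (d (n + 1) z) = 0)
    (g : ∀ q, Q q →ₗ[B] (X.I q →₀ L)) (_hg : ∀ q z, dL k (X.D q) (g (q + 1) z) = g q (d q z))
    (θ : L →+ T' →+ Nit f T (j + 1)) (hθ : Bal k B θ),
    Del f T (j + 1) Q d ((ev hθ X.t).comp (g 0)) 0
  | 0, L, _, _, _, _, hL, Q, _, _, d, hQ, hd, g, hg, θ, hθ => by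
    have : Module.Projective (En k B) L := hL
    obtain ⟨σ, hσ1, hσ2⟩ := hσ (Nit f T 0)
    obtain ⟨θ', hθ', h⟩ := bal_lift hθ (mkN f T 0) σ hσ1 hσ2
    refine ⟨(ev hθ' X.t).comp (g 0), fun z => ev_post k _ hθ' hθ h _ _, 0, fun z => ?_, rfl⟩
    simp only [LinearMap.comp_apply, LinearMap.zero_apply, map_zero]
    rw [← hg, ev_dL]
    exact X.h0
  | j + 1, L, _, _, _, _, hL, Q, _, _, d, hQ, hd, g, hg, θ, hθ => by
    obtain ⟨P, _, _, p, hP, hp, hΩ⟩ := hL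
    letI : Module B P := Module.compHom P
      (Algebra.TensorProduct.includeLeftRingHom : B →+* En k B)
    have : IsScalarTower B (En k B) P := ⟨fun b e x => by
      change (b • e) • x = ((b ⊗ₜ[k] (1 : Bᵐᵒᵖ) : En k B)) • (e • x)
      rw [← mul_smul]
      congr 1
      induction e using TensorProduct.induction_on with
      | zero => simp
      | tmul x y => rw [TensorProduct.smul_tmul', Algebra.TensorProduct.tmul_mul_tmul]; simp
      | add x y hx hy => rw [smul_add, hx, hy, mul_add]⟩
    obtain ⟨σ, hσ1, hσ2⟩ := hσ (Nit f T (j + 1))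
    have hpB : ∀ (b : B) x, p (b • x) = b • p x := (p.restrictScalars B).map_smul
    have hpr : ∀ (b : B) x, p (ra k x b) = ra k (p x) b := fun b x => p.map_smul _ _
    have hθp : Bal k B (θ.comp p.toAddMonoidHom) :=
      ⟨fun b l t => by simp [hpB, hθ.l], fun b l t => by simp [hpr, hθ.r]⟩
    obtain ⟨θ', hθ', h⟩ := bal_lift hθp (mkN f T (j + 1)) σ hσ1 hσ2
    have hex : ∀ (w : LinearMap.ker p) (t : T'), ∃ s, ι f (Nit f T (j + 1)) s = θ' w.1 t := by
      intro w t
      refine (mkN_eq f T _ _).1 ?_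
      rw [h]
      have : p w.1 = 0 := w.2
      simp [this]
    choose s hs using hex
    let θ2 : LinearMap.ker p →+ T' →+ Nit f T (j + 1) :=
      AddMonoidHom.mk' (fun w => AddMonoidHom.mk' (fun t => s w t)
        (fun t t' => hι _ (by simp [hs]))) (fun w w' => by
          ext t; exact hι _ (by simp [hs]))
    have hθ2 : Bal k B θ2 := ⟨fun b l t => hι _ (by
      change ι f _ (s (b • l) t) = ι f _ (b • s l t)
      rw [map_smul, hs, hs, ← hθ'.l]; rfl), fun b l t => hι _ (by
      change ι f _ (s (ra k l b) t) = ι f _ (s l (b • t))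
      rw [hs, hs, ← hθ'.r]; rfl)⟩
    have hgt : ∀ q, ∃ gt : Q q →ₗ[B] (X.I q →₀ P), ∀ z, fm k (X.I q) p (gt z) = g q z := by
      intro q
      have := hQ q
      exact fac_proj _ _ (fun z => Finsupp.mapRange_surjective p (map_zero p) hp _)
    choose gt hgt using hgt
    have hh : ∀ q, ∃ w : Q (q + 1) →ₗ[B] (X.I q →₀ LinearMap.ker p), ∀ z,
        fm k (X.I q) (LinearMap.ker p).subtype (w z)
          = ((-1 : ℤ) ^ q) • (gt q (d q z) - dL k (X.D q) (gt (q + 1) z)) := by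
      intro q
      refine fac_inj _ ?_ (((-1 : ℤ) ^ q) • ((gt q).comp (d q)
        - (dL k (X.D q)).comp (gt (q + 1)))) (fun z => ?_)
      · exact Finsupp.mapRange_injective _ (map_zero _) Subtype.val_injective
      · have hz : fm k (X.I q) p ((((-1 : ℤ) ^ q) • ((gt q).comp (d q)
            - (dL k (X.D q)).comp (gt (q + 1)))) z) = 0 := by
          simp only [LinearMap.smul_apply, map_zsmul, LinearMap.sub_apply, LinearMap.comp_apply,
            map_sub]
          rw [← dL_fm, hgt, hgt, hg, sub_self, smul_zero]
        generalize ((((-1 : ℤ) ^ q) • ((gt q).comp (d q)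
            - (dL k (X.D q)).comp (gt (q + 1)))) z) = x at hz
        refine ⟨Finsupp.onFinset x.support (fun i => ⟨x i, DFunLike.congr_fun hz i⟩) ?_, ?_⟩
        · intro i hi
          rw [Finsupp.mem_support_iff]
          intro h0
          exact hi (Subtype.ext h0)
        · ext i
          rfl
    choose w hw using hh
    have hwc : ∀ q z, dL k (X.D q) (w (q + 1) z) = w q (d (q + 1) z) := by
      intro q z
      have inj : Function.Injective (fm k (X.I q) (LinearMap.ker p).subtype) :=
        Finsupp.mapRange_injective _ (map_zero _) Subtype.val_injective
      apply inj
      rw [← dL_fm, hw, hw, hd, map_zsmul, map_sub, dL_dL k _ _ (X.h1 q), pow_succ]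
      simp
    have IH := lemC hι hσ T X j (LinearMap.ker p) hΩ (fun n => Q (n + 1)) (fun n => d (n + 1))
      (fun n => hQ _) (fun n => hd _) w hwc θ2 hθ2
    refine ⟨(ev hθ' X.t).comp (gt 0), fun z => ?_, _, fun z => ?_, IH⟩
    · simp only [LinearMap.comp_apply]
      rw [ev_post k _ hθ' hθp h, ← ev_fm k p hθ hθp (fun _ _ => rfl), hgt]
    · have hb : Bal k B (θ'.comp (LinearMap.ker p).subtype.toAddMonoidHom) :=
        ⟨fun b l t => hθ'.l b l.1 t, fun b l t => hθ'.r b l.1 t⟩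
      have e1 := ev_post k (ι f (Nit f T (j + 1))) hθ2 hb (fun l t => hs l t) X.t (w 0 z)
      have e2 := ev_fm k (LinearMap.ker p).subtype hθ' hb (fun _ _ => rfl) X.t (w 0 z)
      refine e1.trans (e2.symm.trans ?_)
      rw [hw]
      simp only [pow_zero, one_smul, map_sub, LinearMap.comp_apply]
      rw [ev_dL k _ _ _ X.h0, sub_zero]

lemma chain {L : Type v} [AddCommGroup L] [Module (En k B) L] [Module B L]
    [IsScalarTower B (En k B) L] (R : RC B L (ra k))
    {T U : Type v} [AddCommGroup T] [Module B T] [AddCommGroup U] [Module B U]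
    (X : Res B T) {θ : L →+ T →+ U} (hθ : Bal k B θ) (κ : R.J → U →+ T)
    (hκ : ∀ j l t, κ j (θ l t) = R.c j l • t) (hev : Function.Surjective (ev hθ X.t))
    (Q : ℕ → Type v) [∀ n, AddCommGroup (Q n)]
    [∀ n, Module B (Q n)] (d : ∀ n, Q (n + 1) →ₗ[B] Q n)
    (hQ : ∀ n, Module.Projective B (Q n)) (hd : ∀ n z, d n (d (n + 1) z) = 0)
    (x : Q 0 →ₗ[B] U) (hx : ∀ z, x (d 0 z) = 0) :
    ∃ g : ∀ q, Q q →ₗ[B] (X.I q →₀ L), (∀ z, ev hθ X.t (g 0 z) = x z) ∧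
      ∀ q z, dL k (X.D q) (g (q + 1) z) = g q (d q z) := by
  have := hQ 0
  obtain ⟨g0, hg0⟩ := fac_proj (ev hθ X.t) x (fun z => hev _)
  obtain ⟨s, h1, h2⟩ := exists_seq
    (S := fun q => {g : Q q →ₗ[B] (X.I q →₀ L) // ∀ z, ∃ w, dL k (X.D q) w = g (d q z)})
    ⟨g0, fun z => ev_ex k R hθ κ hκ X.t _ X.e0 _ (by rw [hg0, hx])⟩
    (fun q s s' => ∀ z, dL k (X.D q) (s'.1 z) = s.1 (d q z)) (by
      rintro q ⟨g, hg⟩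
      have := hQ (q + 1)
      obtain ⟨g', hg'⟩ := fac_proj (dL k (X.D q)) (g.comp (d q)) hg
      refine ⟨⟨g', fun z => dL_ex k R (X.D q) _ (X.e1 q) _ ?_⟩, hg'⟩
      rw [hg']
      simp [hd])
  refine ⟨fun q => (s q).1, fun z => ?_, h2⟩
  change ev hθ X.t ((s 0).1 z) = x z
  rw [h1, hg0]

lemma cob (hι : ∀ (T : Type v) [AddCommGroup T] [Module B T], Function.Injective (ι f T))
    (hσ : ∀ (T : Type v) [AddCommGroup T] [Module B T], ∃ σ : Nt f T →+ Tens f T,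
      (∀ u, (LinearMap.range (ι f T)).mkQ (σ u) = u) ∧
      ∀ (c : k) u, σ (algebraMap k B c • u) = algebraMap k B c • σ u)
    {L : Type v} [AddCommGroup L] [Module (En k B) L] [Module B L]
    [IsScalarTower B (En k B) L] (R : RC B L (ra k)) (r : ℕ) (hL : ProjDimLE (En k B) r L)
    (hθ : ∀ (T : Type v) [AddCommGroup T] [Module B T],
      ∃ (θ : L →+ T →+ Nt f T) (hθ : Bal k B θ) (κ : R.J → Nt f T →+ T),
      (∀ j l t, κ j (θ l t) = R.c j l • t) ∧
      ∀ (I : Type v) (t : I → T) (_ : Function.Surjective t), Function.Surjective (ev hθ t))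
    (Q : ℕ → Type v) [∀ n, AddCommGroup (Q n)]
    [∀ n, Module B (Q n)] (d : ∀ n, Q (n + 1) →ₗ[B] Q n)
    (hQ : ∀ n, Module.Projective B (Q n)) (hd : ∀ n z, d n (d (n + 1) z) = 0)
    (hX : XQ f Q d) (T : Type v) [AddCommGroup T] [Module B T]
    (y : Q (r + 2) →ₗ[B] T) (hy : ∀ z, y (d (r + 2) z) = 0) :
    ∃ e : Q (r + 1) →ₗ[B] T, ∀ z, y z = e (d (r + 1) z) := by
  obtain ⟨x, hx, hD⟩ := D1 f (ModuleCat.of B T) (r + 1) Q d hX y hy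
  obtain ⟨θ, hb, κ, hκ, hs⟩ := hθ (Nit f (ModuleCat.of B T) r)
  let X := res B (Nit f (ModuleCat.of B T) r)
  obtain ⟨g, hg0, hg⟩ := chain R X hb κ hκ (hs _ _ X.ht) (fun n => Q (n + 1)) (fun n => d (n + 1))
    (fun n => hQ _) (fun n => hd _) x hx
  have := lemC f hι hσ (ModuleCat.of B T) X r L hL (fun n => Q (n + 1)) (fun n => d (n + 1))
    (fun n => hQ _) (fun n => hd _) g hg θ hb
  have hxe : (ev hb X.t).comp (g 0) = x := LinearMap.ext hg0
  have hD' : Del f (ModuleCat.of B T) (r + 1) (fun n => Q (n + 1)) (fun n => d (n + 1)) x 0 := by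
    rw [← hxe]; exact this
  obtain ⟨e, he⟩ := D2 f hι (ModuleCat.of B T) (r + 1) Q d hQ hd x x y 0 hD hD' 0
    (fun z => by simp)
  exact ⟨e, fun z => by rw [← he]; simp⟩

end C
end GD


namespace GD

set_option linter.unusedSectionVars false

section pd
open CategoryTheory

def PD (R : Type v) [Ring R] (M : Type v) [AddCommGroup M] [Module R M] (n : ℕ) : Prop :=
  HasProjectiveDimensionLT (ModuleCat.of R M) (n + 1)

variable {R : Type v} [Ring R] {X Y Z : Type v} [AddCommGroup X] [Module R X]
    [AddCommGroup Y] [Module R Y] [AddCommGroup Z] [Module R Z]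

lemma pd_zero : PD R X 0 ↔ Module.Projective R X := by
  rw [PD, zero_add, ← projective_iff_hasProjectiveDimensionLT_one, ← IsProjective.iff_projective]

lemma pd_succ [Module.Projective R Y] (g : X →ₗ[R] Y) (h : Y →ₗ[R] Z)
    (hg : Function.Injective g) (e : Function.Exact g h) (hh : Function.Surjective h) (n : ℕ) :
    PD R Z (n + 1) ↔ PD R X n := by
  let S : ShortComplex (ModuleCat.{v} R) := ShortComplex.mk (ModuleCat.ofHom g) (ModuleCat.ofHom h)
    (by ext x; exact e.apply_apply_eq_zero x)
  have hS : S.ShortExact := ModuleCat.shortComplex_shortExact S e hg hh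
  have hP : Projective S.X₂ := (IsProjective.iff_projective Y).1 inferInstance
  exact hS.hasProjectiveDimensionLT_X₃_iff n hP

lemma pd_iso (e : X ≃ₗ[R] Y) (n : ℕ) (h : PD R X n) : PD R Y n := by
  unfold PD at *
  exact hasProjectiveDimensionLT_of_iso e.toModuleIso _

lemma ker_exact (p : X →ₗ[R] Y) : Function.Exact (LinearMap.ker p).subtype p := by
  intro x
  simp

lemma pd_of_projDim : ∀ (n : ℕ) (M : Type v) [AddCommGroup M] [Module R M],
    ProjDimLE R n M → PD R M n
  | 0, M, _, _, h => pd_zero.2 h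
  | n + 1, M, _, _, h => by
    obtain ⟨P, _, _, p, hP, hp, hk⟩ := h
    exact (pd_succ _ p Subtype.val_injective (ker_exact p) hp n).2 (pd_of_projDim n _ hk)

lemma projDim_of_pd : ∀ (n : ℕ) (M : Type v) [AddCommGroup M] [Module R M],
    PD R M n → ProjDimLE R n M
  | 0, M, _, _, h => pd_zero.1 h
  | n + 1, M, _, _, h => by
    have hs : Function.Surjective (Finsupp.linearCombination R (id : M → M)) :=
      fun m => ⟨Finsupp.single m 1, by simp⟩
    exact ⟨M →₀ R, inferInstance, inferInstance, Finsupp.linearCombination R id, inferInstance, hs,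
      projDim_of_pd n _ ((pd_succ _ _ Subtype.val_injective (ker_exact _) hs n).1 h)⟩

end pd

section tp
variable {A B : Type v} [Ring A] [Ring B] (f : B →+* A)

lemma tens_proj (Q : Type v) [AddCommGroup Q] [Module B Q] [Module.Projective B Q] :
    Module.Projective A (Tens f Q) := by
  refine Module.Projective.of_lifting_property'' fun p hp => ?_
  let _ : Module B (Tens f Q →₀ A) := Module.compHom _ f
  let pB : (Tens f Q →₀ A) →ₗ[B] Tens f Q :=
    { toFun := p
      map_add' := map_add p
      map_smul' := fun b x => p.map_smul (f b) x }
  obtain ⟨h, hh⟩ := fac_proj pB (ι f Q) (fun z => hp _)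
  obtain ⟨ψ, hψ⟩ := exists_ext f h.toAddMonoidHom (fun b t => h.map_smul b t)
  refine ⟨ψ, LinearMap.ext fun x => ?_⟩
  change p (ψ x) = x
  induction x using tm_ind with
  | h0 => simp
  | ht a t =>
    rw [hψ, map_smul]
    have := hh t
    change p (h t) = tm f 1 t at this
    change a • p (h t) = _
    rw [this, smul_tm, mul_one]
  | ha x y hx hy => rw [map_add, map_add, hx, hy]

variable (Q : ℕ → Type v) [∀ n, AddCommGroup (Q n)]
    [∀ n, Module B (Q n)] (d : ∀ n, Q (n + 1) →ₗ[B] Q n)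

/-- cokernels of a complex -/
abbrev Zc (n : ℕ) : Type v := Q n ⧸ LinearMap.range (d n)

variable {Q}

lemma zj (hd : ∀ n z, d n (d (n + 1) z) = 0) (he : ∀ n z, d n z = 0 → ∃ w, d (n + 1) w = z) (n : ℕ) :
    ∃ j : Zc Q d (n + 1) →ₗ[B] Q n, (∀ z, j (Submodule.Quotient.mk z) = d n z) ∧
      Function.Injective j ∧ Function.Exact j (LinearMap.range (d n)).mkQ := by
  refine ⟨(LinearMap.range (d (n + 1))).liftQ (d n) ?_, fun z => rfl, ?_, ?_⟩
  · rintro _ ⟨z, rfl⟩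
    exact hd n z
  · rw [injective_iff_map_eq_zero]
    intro x hx
    obtain ⟨x, rfl⟩ := Submodule.Quotient.mk_surjective _ x
    obtain ⟨w, rfl⟩ := he n x hx
    exact (Submodule.Quotient.mk_eq_zero _).2 ⟨w, rfl⟩
  · intro x
    rw [Submodule.mkQ_apply, Submodule.Quotient.mk_eq_zero]
    constructor
    · rintro ⟨z, rfl⟩
      exact ⟨Submodule.Quotient.mk z, rfl⟩
    · rintro ⟨z, rfl⟩
      obtain ⟨z, rfl⟩ := Submodule.Quotient.mk_surjective _ z
      exact ⟨z, rfl⟩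

lemma xq (R : RC B A (fun a b => a * f b)) (hd : ∀ n z, d n (d (n + 1) z) = 0)
    (he : ∀ n z, d n z = 0 → ∃ w, d (n + 1) w = z)
    (hZ : ∀ n, Module.Projective A (Tens f (Zc Q d n))) : XQ f Q d := by
  intro n T _ _ c hc
  obtain ⟨j, hj, hji, hje⟩ := zj d hd he n
  have h1 := tmap_inj f R j hji
  have h2 := tmap_exact f R j _ hje
  have h3 := tmap_surj f (LinearMap.range (d n)).mkQ (Submodule.mkQ_surjective _)
  have := hZ n
  obtain ⟨s, hs⟩ := Module.projective_lifting_property (tmap f (LinearMap.range (d n)).mkQ)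
    LinearMap.id h3
  have hs' : ∀ x, tmap f (LinearMap.range (d n)).mkQ (s x) = x := fun x => LinearMap.congr_fun hs x
  obtain ⟨ρ, hρ⟩ := fac_inj (tmap f j) h1
    (LinearMap.id - s.comp (tmap f (LinearMap.range (d n)).mkQ)) (fun z => by
      refine (h2 _).1 ?_
      simp [hs'])
  have hρ' : ∀ y, ρ (tmap f j y) = y := by
    intro y
    apply h1
    rw [hρ]
    simp [h2.apply_apply_eq_zero]
  let cb : Zc Q d (n + 1) →ₗ[B] Tens f T := (LinearMap.range (d (n + 1))).liftQ c (by
    rintro _ ⟨z, rfl⟩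
    exact hc z)
  obtain ⟨C, hC⟩ := exists_ext f cb.toAddMonoidHom (fun b t => cb.map_smul b t)
  refine ⟨{ toFun := fun q => C (ρ (ι f _ q))
            map_add' := by intros; simp
            map_smul' := fun b q => ?_ }, fun z => ?_⟩
  · rw [map_smul, smulB, map_smul, map_smul]; rfl
  · change c z = C (ρ (tm f 1 (d n z)))
    rw [← hj, ← tmap_tm, hρ', hC, one_smul]
    rfl

lemma zproj (R : RC B A (fun a b => a * f b)) (hd : ∀ n z, d n (d (n + 1) z) = 0)
    (he : ∀ n z, d n z = 0 → ∃ w, d (n + 1) w = z) (hQ : ∀ n, Module.Projective B (Q n))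
    (a : ℕ) (hA : GlobalDimLE.{v, v} A a) (m : ℕ) :
    Module.Projective A (Tens f (Zc Q d (a + m))) := by
  have key : ∀ j c m, c + j = a → PD A (Tens f (Zc Q d (j + m))) c := by
    intro j
    induction j with
    | zero => intro c m hc; obtain rfl : c = a := by omega
              exact pd_of_projDim _ _ (hA _)
    | succ j ih =>
      intro c m hc
      have := ih (c + 1) m (by omega)
      obtain ⟨i, hi, hji, hje⟩ := zj d hd he (j + m)
      have := hQ (j + m)
      have := tens_proj f (Q (j + m))
      have h := (pd_succ _ _ (tmap_inj f R i hji) (tmap_exact f R i _ hje)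
        (tmap_surj f _ (Submodule.mkQ_surjective _)) c).1 ‹_›
      have e : j + 1 + m = j + m + 1 := by omega
      rw [e]
      exact h
  exact pd_zero.1 (key a 0 m (by omega))

lemma pd_back (hd : ∀ n z, d n (d (n + 1) z) = 0)
    (he : ∀ n z, d n z = 0 → ∃ w, d (n + 1) w = z) (hQ : ∀ n, Module.Projective B (Q n)) :
    ∀ j n, PD B (Zc Q d j) n → PD B (Zc Q d 0) (n + j)
  | 0, n, h => h
  | j + 1, n, h => by
    obtain ⟨i, hi, hji, hje⟩ := zj d hd he j
    have := hQ j
    have h' := pd_back hd he hQ j (n + 1) ((pd_succ _ _ hji hje (Submodule.mkQ_surjective _) n).2 h)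
    have e : n + (j + 1) = n + 1 + j := by omega
    rw [e]
    exact h'

end tp

lemma core1 {k : Type u} [CommRing k] {A B : Type v} [Ring A] [Ring B] [Algebra k B] (f : B →+* A)
    (RA : RC B A (fun a b => a * f b)) (a : ℕ) (hA : GlobalDimLE.{v, v} A a)
    (hι : ∀ (T : Type v) [AddCommGroup T] [Module B T], Function.Injective (ι f T))
    (hσ : ∀ (T : Type v) [AddCommGroup T] [Module B T], ∃ σ : Nt f T →+ Tens f T,
      (∀ u, (LinearMap.range (ι f T)).mkQ (σ u) = u) ∧
      ∀ (c : k) u, σ (algebraMap k B c • u) = algebraMap k B c • σ u)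
    {L : Type v} [AddCommGroup L] [Module (En k B) L] [Module B L]
    [IsScalarTower B (En k B) L] (R : RC B L (ra k)) (r : ℕ) (hL : ProjDimLE (En k B) r L)
    (hθ : ∀ (T : Type v) [AddCommGroup T] [Module B T],
      ∃ (θ : L →+ T →+ Nt f T) (hθ : Bal k B θ) (κ : R.J → Nt f T →+ T),
      (∀ j l t, κ j (θ l t) = R.c j l • t) ∧
      ∀ (I : Type v) (t : I → T) (_ : Function.Surjective t), Function.Surjective (ev hθ t))
    (Q : ℕ → Type v) [∀ n, AddCommGroup (Q n)]
    [∀ n, Module B (Q n)] (d : ∀ n, Q (n + 1) →ₗ[B] Q n)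
    (hQ : ∀ n, Module.Projective B (Q n)) (hd : ∀ n z, d n (d (n + 1) z) = 0)
    (he : ∀ n z, d n z = 0 → ∃ w, d (n + 1) w = z) :
    PD B (Zc Q d 0) (0 + (a + (r + 1))) := by
  have hz : ∀ n, Module.Projective A (Tens f (Zc (fun n => Q (a + n)) (fun n => d (a + n)) n)) := by
    intro n
    have := zproj f d RA hd he hQ a hA n
    exact this
  have hX : XQ f (fun n => Q (a + n)) (fun n => d (a + n)) :=
    xq (Q := fun n => Q (a + n)) f (fun n => d (a + n)) RA (fun n => hd (a + n))
      (fun n => he (a + n)) hz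
  obtain ⟨e, he'⟩ := cob f hι hσ R r hL hθ (fun n => Q (a + n)) (fun n => d (a + n))
    (fun n => hQ _) (fun n => hd _) hX (LinearMap.range (d (a + (r + 1))))
    (d (a + (r + 1))).rangeRestrict (fun z => Subtype.ext (hd _ _))
  have hp : Module.Projective B (Zc Q d (a + (r + 1))) := by
    have := hQ (a + (r + 1))
    refine Module.Projective.of_split ((LinearMap.range (d (a + (r + 1)))).liftQ
      (LinearMap.id - (LinearMap.range (d (a + (r + 1)))).subtype.comp e) ?_)
      (LinearMap.range (d (a + (r + 1)))).mkQ ?_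
    · rintro _ ⟨z, rfl⟩
      have := congrArg Subtype.val (he' z)
      change d (a + (r + 1)) z = (e (d (a + (r + 1)) z)).1 at this
      change d (a + (r + 1)) z - (e (d (a + (r + 1)) z)).1 = 0
      rw [← this, sub_self]
    · refine LinearMap.ext fun x => ?_
      obtain ⟨x, rfl⟩ := Submodule.Quotient.mk_surjective _ x
      change Submodule.Quotient.mk (x - (e x).1) = Submodule.Quotient.mk x
      rw [Submodule.Quotient.eq]
      have := (e x).2
      simp
  exact pd_back d hd he hQ _ 0 (pd_zero.2 hp)

lemma core {k : Type u} [CommRing k] {A B : Type v} [Ring A] [Ring B] [Algebra k B] (f : B →+* A)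
    (RA : RC B A (fun a b => a * f b)) (a : ℕ) (hA : GlobalDimLE.{v, v} A a)
    (hι : ∀ (T : Type v) [AddCommGroup T] [Module B T], Function.Injective (ι f T))
    (hσ : ∀ (T : Type v) [AddCommGroup T] [Module B T], ∃ σ : Nt f T →+ Tens f T,
      (∀ u, (LinearMap.range (ι f T)).mkQ (σ u) = u) ∧
      ∀ (c : k) u, σ (algebraMap k B c • u) = algebraMap k B c • σ u)
    {L : Type v} [AddCommGroup L] [Module (En k B) L] [Module B L]
    [IsScalarTower B (En k B) L] (R : RC B L (ra k)) (r : ℕ) (hL : ProjDimLE (En k B) r L)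
    (hθ : ∀ (T : Type v) [AddCommGroup T] [Module B T],
      ∃ (θ : L →+ T →+ Nt f T) (hθ : Bal k B θ) (κ : R.J → Nt f T →+ T),
      (∀ j l t, κ j (θ l t) = R.c j l • t) ∧
      ∀ (I : Type v) (t : I → T) (_ : Function.Surjective t), Function.Surjective (ev hθ t)) :
    GlobalDimLE.{v, v} B (r + a + 1) := by
  intro M _ _
  obtain ⟨X⟩ : Nonempty (Res B M) := ⟨res B M⟩
  have hds : ∀ n i b, Finsupp.linearCombination B (X.D n) (Finsupp.single i b) = b • X.D n i :=
    fun n i b => Finsupp.linearCombination_single B b i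
  have h0 := core1 f RA a hA hι hσ R r hL hθ (fun n => X.I n →₀ B)
    (fun n => Finsupp.linearCombination B (X.D n)) (fun n => inferInstance) (fun n z => by
      induction z using Finsupp.induction_linear with
      | zero => simp only [map_zero]
      | add x y hx hy => rw [map_add, map_add, hx, hy, add_zero]
      | single i b => rw [hds, map_smul, X.h1 n i, smul_zero])
    (fun n z hz => by
      obtain ⟨i, hi⟩ := X.e1 n z hz
      exact ⟨Finsupp.single i 1, by rw [hds, hi, one_smul]⟩)
  have hsurj : Function.Surjective (Finsupp.linearCombination B X.t) := fun m => by
    obtain ⟨i, hi⟩ := X.ht m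
    exact ⟨Finsupp.single i 1, by simp [hi]⟩
  have hker : LinearMap.range (Finsupp.linearCombination B (X.D 0)) = LinearMap.ker (Finsupp.linearCombination B X.t) := by
    ext x
    constructor
    · rintro ⟨z, rfl⟩
      rw [LinearMap.mem_ker]
      induction z using Finsupp.induction_linear with
      | zero => simp
      | add x y hx hy => rw [map_add, map_add, hx, hy, add_zero]
      | single i b =>
        rw [hds, map_smul, X.h0, smul_zero]
    · intro hx
      obtain ⟨i, hi⟩ := X.e0 x hx
      exact ⟨Finsupp.single i 1, by rw [hds, hi, one_smul]⟩
  have h1 := pd_iso ((Submodule.quotEquivOfEq _ _ hker).trans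
    (LinearMap.quotKerEquivOfSurjective _ hsurj)) _ h0
  have e : r + a + 1 = 0 + (a + (r + 1)) := by omega
  rw [e]
  exact projDim_of_pd _ _ h1

end GD


namespace GD

set_option linter.unusedSectionVars false

lemma dsc {X Y G : Type v} [AddCommGroup X] [AddCommGroup Y] [AddCommGroup G] (m : X →+ Y)
    (hm : Function.Surjective m) (φ : X →+ G) (h : ∀ x, m x = 0 → φ x = 0) :
    ∃ ψ : Y →+ G, ∀ x, ψ (m x) = φ x := by
  choose g hg using hm
  have key : ∀ x y, m x = m y → φ x = φ y := by
    intro x y hxy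
    rw [← sub_eq_zero, ← map_sub]
    exact h _ (by rw [map_sub, hxy, sub_self])
  refine ⟨AddMonoidHom.mk' (fun y => φ (g y)) (fun a b => ?_), fun x => key _ _ (hg _)⟩
  change φ (g (a + b)) = φ (g a) + φ (g b)
  rw [← map_add]
  exact key _ _ (by simp [hg])

lemma stow {k : Type u} [CommRing k] {B : Type v} [Ring B] [Algebra k B] {P : Type v}
    [AddCommGroup P] [Module (En k B) P] [Module B P]
    (h : ∀ (b : B) (x : P), b • x = ((b ⊗ₜ[k] (1 : Bᵐᵒᵖ) : En k B)) • x) :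
    IsScalarTower B (En k B) P := ⟨fun b e x => by
  rw [h, ← mul_smul]
  congr 1
  induction e using TensorProduct.induction_on with
  | zero => simp
  | tmul x y => rw [TensorProduct.smul_tmul', Algebra.TensorProduct.tmul_mul_tmul]; simp
  | add x y hx hy => rw [smul_add, hx, hy, mul_add]⟩

/-- the coordinate data used in the proof -/
structure Dat {A B : Type v} [Ring A] [Ring B] (f : B →+* A) where
  J : Type v
  c : J → A →+ B
  p : J → A
  π : A →+ B
  hc : ∀ j a b, c j (a * f b) = c j a * b
  hc0 : ∀ j b, c j (f b) = 0
  hπ : ∀ a b, π (a * f b) = π a * b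
  hπ1 : π 1 = 1
  hs : ∀ a, ∃ s : Finset J, ∀ s', s ⊆ s' → ∑ j ∈ s', p j * f (c j a) = a - f (π a)

section dat
variable {A B : Type v} [Ring A] [Ring B] {f : B →+* A}

lemma Dat.rc (Δ : Dat f) : Nonempty (RC B A (fun a b => a * f b)) := by
  classical
  refine ⟨{ J := Option Δ.J
            c := fun j => j.elim Δ.π Δ.c
            p := fun j => j.elim 1 Δ.p
            hc := ?_
            hp := ?_ }⟩
  · rintro (_ | j) a b
    · exact Δ.hπ a b
    · exact Δ.hc j a b
  · intro a
    obtain ⟨s, hs⟩ := Δ.hs a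
    refine ⟨Finset.insertNone s, fun s' h => ?_⟩
    have hn : none ∈ s' := h (by simp)
    have e : s' = Finset.insertNone (Finset.eraseNone s') := by
      rw [Finset.insertNone_eraseNone, Finset.insert_eq_of_mem hn]
    rw [e, Finset.sum_insertNone]
    have := hs (Finset.eraseNone s') (fun j hj => by
      rw [Finset.mem_eraseNone]
      exact h (by simpa using hj))
    simp only [Option.elim]
    rw [this]
    simp

lemma Dat.ret (Δ : Dat f) (T : Type v) [AddCommGroup T] [Module B T] :
    ∃ ρ : Tens f T →+ T, ∀ a t, ρ (tm f a t) = Δ.π a • t :=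
  exists_lift f (G := T) (T := T)
    (AddMonoidHom.mk' (fun a => AddMonoidHom.mk' (fun t => Δ.π a • t) (by intros; simp))
      (by intros; ext; simp [add_smul])) (by intro a b t; simp [Δ.hπ, mul_smul])

lemma Dat.inj (Δ : Dat f) (T : Type v) [AddCommGroup T] [Module B T] : Function.Injective (ι f T) := by
  obtain ⟨ρ, hρ⟩ := Δ.ret T
  refine Function.LeftInverse.injective (g := ρ) fun t => ?_
  change ρ (tm f 1 t) = t
  rw [hρ, Δ.hπ1, one_smul]

lemma Dat.sec (Δ : Dat f) {k : Type u} [CommRing k] [Algebra k B]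
    (hk : ∀ (c : k) (a : A), f (algebraMap k B c) * a = a * f (algebraMap k B c))
    (T : Type v) [AddCommGroup T] [Module B T] : ∃ σ : Nt f T →+ Tens f T,
      (∀ u, (LinearMap.range (ι f T)).mkQ (σ u) = u) ∧
      ∀ (c : k) u, σ (algebraMap k B c • u) = algebraMap k B c • σ u := by
  obtain ⟨ρ, hρ⟩ := Δ.ret T
  have hι : ∀ t, ρ (ι f T t) = t := by
    intro t
    change ρ (tm f 1 t) = t
    rw [hρ, Δ.hπ1, one_smul]
  have hρk : ∀ (c : k) x, ρ (algebraMap k B c • x) = algebraMap k B c • ρ x := by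
    intro c x
    induction x using tm_ind with
    | h0 => simp
    | ht a t => rw [smulB, smul_tm, hρ, hρ, hk, Δ.hπ, smul_smul, Algebra.commutes]
    | ha x y hx hy => simp [hx, hy]
  obtain ⟨σ, hσ⟩ := dsc (LinearMap.range (ι f T)).mkQ.toAddMonoidHom (Submodule.mkQ_surjective _)
    (AddMonoidHom.id _ - (ι f T).toAddMonoidHom.comp ρ) (by
      intro x hx
      obtain ⟨t, rfl⟩ := (Submodule.Quotient.mk_eq_zero _).1 hx
      simp [hι])
  have hσ' : ∀ x, σ ((LinearMap.range (ι f T)).mkQ x) = x - ι f T (ρ x) := hσ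
  refine ⟨σ, fun u => ?_, fun c u => ?_⟩
  · obtain ⟨x, rfl⟩ := Submodule.mkQ_surjective _ u
    rw [hσ', map_sub, sub_eq_self]
    exact (Submodule.Quotient.mk_eq_zero _).2 ⟨_, rfl⟩
  · obtain ⟨x, rfl⟩ := Submodule.mkQ_surjective _ u
    rw [← map_smul, hσ', hσ', hρk, map_smul, smul_sub]

variable {k : Type u} [CommRing k] [Algebra k B] {L : Type v} [AddCommGroup L]
  [Module (En k B) L] [Module B L] [IsScalarTower B (En k B) L]

lemma Dat.fin (Δ : Dat f) (hk : ∀ (c : k) (a : A), f (algebraMap k B c) * a = a * f (algebraMap k B c))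
    (m : A →+ L) (hm : Function.Surjective m) (hm0 : ∀ x, m x = 0 ↔ ∃ b, f b = x)
    (hml : ∀ b x, m (f b * x) = b • m x) (hmr : ∀ x b, ra k (m x) b = m (x * f b))
    (a r : ℕ) (hA : GlobalDimLE.{v, v} A a) (hL : ProjDimLE (En k B) r L) :
    GlobalDimLE.{v, v} B (r + a + 1) := by
  obtain ⟨RA⟩ := Δ.rc
  have hcl : ∀ j, ∃ cl : L →+ B, ∀ x, cl (m x) = Δ.c j x := fun j => dsc m hm (Δ.c j) (by
    intro x hx
    obtain ⟨b, rfl⟩ := (hm0 x).1 hx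
    exact Δ.hc0 j b)
  choose cl hcl using hcl
  have hc : ∀ j l b, cl j (ra k l b) = cl j l * b := by
    intro j l b
    obtain ⟨x, rfl⟩ := hm l
    rw [hmr, hcl, hcl, Δ.hc]
  have hp : ∀ l, ∃ s : Finset Δ.J, ∀ s', s ⊆ s' → ∑ j ∈ s', ra k (m (Δ.p j)) (cl j l) = l := by
    intro l
    obtain ⟨x, rfl⟩ := hm l
    obtain ⟨s, hs⟩ := Δ.hs x
    refine ⟨s, fun s' h => ?_⟩
    simp only [hmr, hcl]
    rw [← map_sum, hs s' h, map_sub, sub_eq_self]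
    exact (hm0 _).2 ⟨_, rfl⟩
  refine core f RA a hA (fun T _ _ => Δ.inj T) (fun T _ _ => Δ.sec hk T)
    (L := L) ⟨Δ.J, cl, fun j => m (Δ.p j), hc, hp⟩ r hL (fun T _ _ => ?_)
  obtain ⟨θ, hθ⟩ := dsc m hm (G := T →+ Nt f T)
    (AddMonoidHom.mk' (fun x => AddMonoidHom.mk'
      (fun t => (LinearMap.range (ι f T)).mkQ (tm f x t)) (by intros; rw [tm_add, map_add]))
      (by intros; ext t; simp [add_tm])) (by
      intro x hx
      obtain ⟨b, rfl⟩ := (hm0 x).1 hx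
      ext t
      refine (Submodule.Quotient.mk_eq_zero _).2 ⟨b • t, ?_⟩
      change tm f 1 (b • t) = tm f (f b) t
      rw [← tm_bal, one_mul])
  have hθ' : ∀ x t, θ (m x) t = (LinearMap.range (ι f T)).mkQ (tm f x t) :=
    fun x t => DFunLike.congr_fun (hθ x) t
  have hbal : Bal k B θ := by
    constructor
    · intro b l t
      obtain ⟨x, rfl⟩ := hm l
      rw [← hml, hθ', hθ', ← map_smul, smulB, smul_tm]
    · intro b l t
      obtain ⟨x, rfl⟩ := hm l
      rw [hmr, hθ', hθ', tm_bal]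
  have hκ : ∀ j, ∃ κ : Nt f T →+ T, ∀ x t, κ ((LinearMap.range (ι f T)).mkQ (tm f x t))
      = Δ.c j x • t := by
    intro j
    obtain ⟨κ0, h0⟩ := exists_lift f (G := T) (T := T)
      (AddMonoidHom.mk' (fun a => AddMonoidHom.mk' (fun t => Δ.c j a • t) (by intros; simp))
      (by intros; ext; simp [add_smul])) (by intro a b t; simp [Δ.hc, mul_smul])
    obtain ⟨κ, hκ⟩ := dsc (LinearMap.range (ι f T)).mkQ.toAddMonoidHom
      (Submodule.mkQ_surjective _) κ0 (by
      intro x hx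
      obtain ⟨t, rfl⟩ := (Submodule.Quotient.mk_eq_zero _).1 hx
      change κ0 (tm f 1 t) = 0
      have h1 := Δ.hc0 j 1
      rw [map_one] at h1
      rw [h0]
      simp [h1])
    exact ⟨κ, fun x t => (hκ _).trans (h0 _ _)⟩
  choose κ hκ using hκ
  refine ⟨θ, hbal, κ, fun j l t => ?_, fun I t ht u => ?_⟩
  · obtain ⟨x, rfl⟩ := hm l
    rw [hθ', hκ]
    change _ = cl j (m x) • t
    rw [hcl]
  · obtain ⟨x, rfl⟩ := Submodule.mkQ_surjective _ u
    induction x using tm_ind with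
    | h0 => exact ⟨0, by simp⟩
    | ht a s =>
      obtain ⟨i, rfl⟩ := ht s
      exact ⟨Finsupp.single i (m a), by rw [ev_single, hθ']⟩
    | ha x y hx hy =>
      obtain ⟨x', hx⟩ := hx
      obtain ⟨y', hy⟩ := hy
      exact ⟨x' + y', by rw [map_add, map_add, hx, hy]⟩

end dat

lemma mk_dat {A B : Type v} [Ring A] [Ring B] (f : B →+* A) (hf : Function.Injective f)
    [Module Bᵐᵒᵖ A] (hr : ∀ (b : B) (x : A), (MulOpposite.op b) • x = x * f b)
    (hproj : Module.Projective Bᵐᵒᵖ (A ⧸ Submodule.span Bᵐᵒᵖ (Set.range ⇑f))) :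
    Nonempty (Dat f) := by
  have hI : ∀ x, x ∈ Submodule.span Bᵐᵒᵖ (Set.range ⇑f) → ∃ b, f b = x := by
    intro x hx
    refine Submodule.span_induction ?_ ?_ ?_ ?_ hx
    · rintro _ ⟨b, rfl⟩
      exact ⟨b, rfl⟩
    · exact ⟨0, map_zero _⟩
    · rintro _ _ _ _ ⟨b, rfl⟩ ⟨c, rfl⟩
      exact ⟨b + c, map_add _ _ _⟩
    · rintro b _ _ ⟨c, rfl⟩
      exact ⟨c * b.unop, by rw [map_mul, ← hr]; rfl⟩
  let I := Submodule.span Bᵐᵒᵖ (Set.range ⇑f)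
  have hmem : ∀ b, f b ∈ I := fun b => Submodule.subset_span ⟨b, rfl⟩
  obtain ⟨s, hs⟩ := Module.projective_def'.1 hproj
  obtain ⟨σ, hσ⟩ := Module.projective_lifting_property I.mkQ LinearMap.id I.mkQ_surjective
  have hs' : ∀ x, Finsupp.linearCombination Bᵐᵒᵖ (id : A ⧸ I → A ⧸ I) (s x) = x :=
    fun x => LinearMap.congr_fun hs x
  have hσ' : ∀ x, I.mkQ (σ x) = x := fun x => LinearMap.congr_fun hσ x
  have hπ : ∀ a, ∃ b, f b = a - σ (I.mkQ a) := by
    intro a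
    refine hI _ ((Submodule.Quotient.mk_eq_zero I).1 ?_)
    change I.mkQ _ = 0
    rw [map_sub, hσ', sub_self]
  choose π hπ using hπ
  have hmk : ∀ a b, I.mkQ (a * f b) = MulOpposite.op b • I.mkQ a := by
    intro a b
    rw [← hr, map_smul]
  have hmk0 : ∀ b, I.mkQ (f b) = 0 := fun b => (Submodule.Quotient.mk_eq_zero I).2 (hmem b)
  refine ⟨{ J := A ⧸ I
            c := fun j => AddMonoidHom.mk' (fun a => (s (I.mkQ a) j).unop) (by intros; simp)
            p := fun j => σ j
            π := AddMonoidHom.mk' π (fun a b => hf (by rw [map_add, hπ, hπ, hπ, map_add, map_add]; abel))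
            hc := ?_
            hc0 := ?_
            hπ := ?_
            hπ1 := ?_
            hs := ?_ }⟩
  · intro j a b
    change (s (I.mkQ (a * f b)) j).unop = (s (I.mkQ a) j).unop * b
    rw [hmk, map_smul]
    simp
  · intro j b
    change (s (I.mkQ (f b)) j).unop = 0
    rw [hmk0, map_zero]
    rfl
  · intro a b
    apply hf
    change f (π (a * f b)) = f (π a * b)
    rw [map_mul, hπ, hπ, hmk, map_smul, hr, sub_mul]
  · apply hf
    change f (π 1) = f 1
    rw [hπ, ← map_one f, hmk0, map_zero, sub_zero]
  · intro a
    refine ⟨(s (I.mkQ a)).support, fun s' h => ?_⟩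
    change ∑ j ∈ s', σ j * f ((s (I.mkQ a) j).unop) = a - f (π a)
    rw [hπ, sub_sub_cancel]
    conv_rhs => rw [← hs' (I.mkQ a)]
    rw [Finsupp.linearCombination_apply, Finsupp.sum_of_support_subset _ h _ (by simp), map_sum]
    refine Finset.sum_congr rfl fun j _ => ?_
    rw [map_smul, ← hr]
    rfl

end GD

theorem stmt2 (k : Type u) [CommRing k]
    (B : Type v) [Ring B] [Algebra k B] (A : Type v) [Ring A] [Algebra k A]
    (f : B →ₐ[k] A) (hf : Function.Injective f)
    -- the `B`-bimodule structure on `A` induced by the extension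
    [Module (B ⊗[k] Bᵐᵒᵖ) A]
    (hbim : ∀ (b b' : B) (x : A), (b ⊗ₜ[k] (MulOpposite.op b')) • x = f b * x * f b')
    -- the right `B`-module structure on `A` induced by the extension
    [Module Bᵐᵒᵖ A] (hr : ∀ (b : B) (x : A), (MulOpposite.op b) • x = x * f b)
    (a r : ℕ)
    -- `A` has left global dimension at most `a`
    (hA : GlobalDimLE.{v, v} A a)
    -- `A/B` has projective dimension at most `r` as a `B`-bimodule
    (hpd : ProjDimLE (B ⊗[k] Bᵐᵒᵖ) r (A ⧸ Submodule.span (B ⊗[k] Bᵐᵒᵖ) (Set.range ⇑f)))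
    -- `A/B` is projective as a right `B`-module
    (hproj : Module.Projective Bᵐᵒᵖ (A ⧸ Submodule.span Bᵐᵒᵖ (Set.range ⇑f))) :
    GlobalDimLE.{v, v} B (r + a + 1) := by
  obtain ⟨Δ⟩ := GD.mk_dat (f : B →+* A) hf hr hproj
  have hI : ∀ x, x ∈ Submodule.span (B ⊗[k] Bᵐᵒᵖ) (Set.range ⇑f) → ∃ b, f b = x := by
    intro x hx
    refine Submodule.span_induction ?_ ?_ ?_ ?_ hx
    · rintro _ ⟨b, rfl⟩
      exact ⟨b, rfl⟩
    · exact ⟨0, map_zero _⟩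
    · rintro _ _ _ _ ⟨b, rfl⟩ ⟨c, rfl⟩
      exact ⟨b + c, map_add _ _ _⟩
    · rintro e _ _ ⟨c, rfl⟩
      induction e using TensorProduct.induction_on with
      | zero =>
        have h : (0 : B ⊗[k] Bᵐᵒᵖ) • f c = 0 := zero_smul (B ⊗[k] Bᵐᵒᵖ) (f c)
        exact ⟨0, (map_zero f).trans h.symm⟩
      | tmul x y =>
        obtain ⟨y, rfl⟩ := MulOpposite.op_surjective y
        exact ⟨x * c * y, by rw [hbim, map_mul, map_mul]⟩
      | add x y hx hy =>
        obtain ⟨x', hx⟩ := hx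
        obtain ⟨y', hy⟩ := hy
        exact ⟨x' + y', by rw [map_add, hx, hy]; exact (add_smul x y (f c)).symm⟩
  let I := Submodule.span (B ⊗[k] Bᵐᵒᵖ) (Set.range ⇑f)
  let _ : Module B (A ⧸ I) := Module.compHom (A ⧸ I)
    (Algebra.TensorProduct.includeLeftRingHom : B →+* B ⊗[k] Bᵐᵒᵖ)
  have hst : IsScalarTower B (GD.En k B) (A ⧸ I) := GD.stow (fun b x => rfl)
  refine Δ.fin (k := k) (L := A ⧸ I) ?_ I.mkQ.toAddMonoidHom I.mkQ_surjective ?_ ?_ ?_ a r hA hpd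
  · intro c x
    change f (algebraMap k B c) * x = x * f (algebraMap k B c)
    rw [AlgHom.commutes, Algebra.commutes]
  · intro x
    constructor
    · intro hx
      exact hI x ((Submodule.Quotient.mk_eq_zero I).1 hx)
    · rintro ⟨b, rfl⟩
      exact (Submodule.Quotient.mk_eq_zero I).2 (Submodule.subset_span ⟨b, rfl⟩)
  · intro b x
    change I.mkQ (f b * x) = (b ⊗ₜ[k] (MulOpposite.op 1) : B ⊗[k] Bᵐᵒᵖ) • I.mkQ x
    rw [← map_smul, hbim, map_one, mul_one]
  · intro x b
    change ((1 : B) ⊗ₜ[k] (MulOpposite.op b) : B ⊗[k] Bᵐᵒᵖ) • I.mkQ x = I.mkQ (x * f b)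
    rw [← map_smul, hbim, map_one, one_mul]
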